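/- Define φ : ℝ → (0,∞) by φ(u) = e^{(u+1)²/2} for u ≥ 0 and φ(u) = e^{u + 1/2} for u ≤ 0, and let μ be a non-atomic, σ-finite measure with μ(T) > 0. Then no measurable function u₀ : T → (0,∞) satisfies condition (C) for φ; that is, for every measurable u₀ : T → (0,∞) there exist a measurable function c : T → ℝ with ∫_T φ(c) dμ < ∞ and some λ > 0 such that ∫_T φ(c + λu₀) dμ = ∞. -/

import Mathlib

open MeasureTheory Filter Set

lemma aux_small {T : Type*} [MeasurableSpace T] (μ : Measure T)
    (hna : ∀ A : Set T, MeasurableSet A → 0 < μ A →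
      ∃ B ⊆ A, MeasurableSet B ∧ 0 < μ B ∧ μ B < μ A)
    (A : Set T) (hA : MeasurableSet A) (hpos : 0 < μ A) (hfin : μ A < ⊤)
    (ε : ENNReal) (hε : 0 < ε) :
    ∃ B ⊆ A, MeasurableSet B ∧ 0 < μ B ∧ μ B < ε := by
  have half : ∀ A : Set T, MeasurableSet A → 0 < μ A → μ A < ⊤ →
      ∃ B ⊆ A, MeasurableSet B ∧ 0 < μ B ∧ 2 * μ B ≤ μ A := by
    intro A hA hpos hfin
    obtain ⟨B, hBA, hB, hB0, hBlt⟩ := hna A hA hpos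
    have hadd : μ B + μ (A \ B) = μ A := by
      rw [measure_add_diff hB.nullMeasurableSet, union_eq_self_of_subset_left hBA]
    rcases le_total (μ B) (μ (A \ B)) with h | h
    · refine ⟨B, hBA, hB, hB0, ?_⟩
      rw [two_mul, ← hadd]; gcongr
    · refine ⟨A \ B, diff_subset, hA.diff hB, ?_, ?_⟩
      · rw [pos_iff_ne_zero]; intro h0
        rw [h0, add_zero] at hadd
        exact hBlt.ne hadd
      · rw [two_mul, ← hadd]; gcongr
  have iter : ∀ n : ℕ, ∃ B ⊆ A, MeasurableSet B ∧ 0 < μ B ∧ 2 ^ n * μ B ≤ μ A := by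
    intro n
    induction n with
    | zero => exact ⟨A, Subset.rfl, hA, hpos, by simp⟩
    | succ n ih =>
      obtain ⟨B, hBA, hB, hB0, hle⟩ := ih
      obtain ⟨C, hCB, hC, hC0, hCle⟩ := half B hB hB0 ((measure_mono hBA).trans_lt hfin)
      refine ⟨C, hCB.trans hBA, hC, hC0, ?_⟩
      calc 2 ^ (n+1) * μ C = 2 ^ n * (2 * μ C) := by rw [pow_succ, mul_assoc]
        _ ≤ 2 ^ n * μ B := by gcongr
        _ ≤ μ A := hle
  by_contra! hcon
  have key : ∀ n : ℕ, (n : ENNReal) * ε ≤ μ A := by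
    intro n
    obtain ⟨B, hBA, hB, hB0, hle⟩ := iter n
    refine le_trans ?_ hle
    gcongr
    · exact_mod_cast (Nat.lt_two_pow_self).le
    · exact hcon B hBA hB hB0
  obtain ⟨n, hn⟩ := ENNReal.exists_nat_mul_gt hε.ne' hfin.ne
  exact absurd (key n) (not_le.mpr hn)

lemma aux_seq {T : Type*} [MeasurableSpace T] (μ : Measure T)
    (hna : ∀ A : Set T, MeasurableSet A → 0 < μ A →
      ∃ B ⊆ A, MeasurableSet B ∧ 0 < μ B ∧ μ B < μ A)
    (A : Set T) (hA : MeasurableSet A) (hpos : 0 < μ A) (hfin : μ A < ⊤)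
    (ε : ℕ → ENNReal) (hε : ∀ n, 0 < ε n) :
    ∃ E : ℕ → Set T, (∀ n, MeasurableSet (E n)) ∧ (∀ n, E n ⊆ A) ∧
      (∀ n, 0 < μ (E n)) ∧ (∀ n, μ (E n) < ε n) ∧ Pairwise (fun i j => Disjoint (E i) (E j)) := by
  let P : Set T → Prop := fun B => B ⊆ A ∧ MeasurableSet B ∧ 0 < μ B
  have step : ∀ (n : ℕ) (B : {B // P B}), ∃ C : {B // P B}, C.1 ⊆ B.1 ∧ μ C.1 < μ B.1 ∧
      μ C.1 < ε n := by
    rintro n ⟨B, hBA, hB, hB0⟩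
    obtain ⟨C, hCB, hC, hC0, hlt⟩ := aux_small μ hna B hB hB0
      ((measure_mono hBA).trans_lt hfin) (min (μ B) (ε n)) (lt_min hB0 (hε n))
    exact ⟨⟨C, hCB.trans hBA, hC, hC0⟩, hCB, hlt.trans_le (min_le_left _ _),
      hlt.trans_le (min_le_right _ _)⟩
  choose f hf1 hf2 hf3 using step
  let B : ℕ → {B // P B} := fun n => Nat.rec ⟨A, Subset.rfl, hA, hpos⟩ (fun n b => f n b) n
  have hBs : ∀ n, B (n+1) = f n (B n) := fun n => rfl
  have hanti : Antitone (fun n => (B n).1) := antitone_nat_of_succ_le (fun n => by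
    rw [hBs]; exact hf1 n (B n))
  refine ⟨fun n => (B (n+1)).1 \ (B (n+2)).1, fun n => (B (n+1)).2.2.1.diff (B (n+2)).2.2.1,
    fun n => diff_subset.trans (B (n+1)).2.1, fun n => ?_, fun n => ?_, ?_⟩
  · have h : μ (B (n+2)).1 < μ (B (n+1)).1 := by rw [hBs (n+1)]; exact hf2 _ _
    rw [pos_iff_ne_zero]; intro h0
    have h1 := measure_mono_ae (μ := μ) (s := (B (n+1)).1) (t := (B (n+2)).1)
      (ae_le_set.mpr h0)
    exact absurd h1 (not_le.mpr h)
  · refine (measure_mono diff_subset).trans_lt ?_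
    rw [hBs n]; exact hf3 _ _
  · have hd : ∀ i j, i < j →
        Disjoint ((B (i+1)).1 \ (B (i+2)).1) ((B (j+1)).1 \ (B (j+2)).1) := by
      intro i j hij
      rw [Set.disjoint_left]
      rintro x ⟨_, hx⟩ ⟨hx2, _⟩
      exact hx (hanti (show i + 2 ≤ j + 1 by omega) hx2)
    intro i j hij
    rcases lt_or_gt_of_ne hij with h | h
    · exact hd i j h
    · exact (hd j i h).symm

theorem counterexample_no_u0
    {T : Type*} [MeasurableSpace T] (μ : Measure T) [SigmaFinite μ]
    (hμpos : 0 < μ Set.univ)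
    (hna : ∀ A : Set T, MeasurableSet A → 0 < μ A →
      ∃ B ⊆ A, MeasurableSet B ∧ 0 < μ B ∧ μ B < μ A)
    (φ : ℝ → ℝ)
    (hφ : ∀ u : ℝ, φ u = if 0 ≤ u then Real.exp ((u + 1) ^ 2 / 2)
      else Real.exp (u + 1 / 2)) :
    ∀ u₀ : T → ℝ, Measurable u₀ → (∀ t, 0 < u₀ t) →
      ∃ c : T → ℝ, Measurable c ∧ (∫⁻ t, ENNReal.ofReal (φ (c t)) ∂μ < ⊤) ∧
        ∃ lam : ℝ, 0 < lam ∧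
          ∫⁻ t, ENNReal.ofReal (φ (c t + lam * u₀ t)) ∂μ = ⊤ := by
  intro u₀ hu hu0
  -- a set of finite positive measure on which `u₀` is bounded below
  obtain ⟨k, hk⟩ : ∃ k : ℕ, 0 < μ ({t | 1 / ((k : ℝ) + 1) ≤ u₀ t} ∩ spanningSets μ k) := by
    apply exists_measure_pos_of_not_measure_iUnion_null
    intro h0
    refine hμpos.ne' (measure_mono_null (fun t _ => ?_) h0)
    obtain ⟨i, hi⟩ := exists_nat_one_div_lt (hu0 t)
    have ht : t ∈ ⋃ j, spanningSets μ j := by rw [iUnion_spanningSets]; trivial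
    obtain ⟨j, hj⟩ := mem_iUnion.mp ht
    refine mem_iUnion.mpr ⟨max i j, ?_, monotone_spanningSets μ (le_max_right i j) hj⟩
    refine le_trans ?_ hi.le
    have : (i : ℝ) ≤ (max i j : ℕ) := by exact_mod_cast le_max_left i j
    exact one_div_le_one_div_of_le (by positivity) (by linarith)
  set A := {t | 1 / ((k : ℝ) + 1) ≤ u₀ t} ∩ spanningSets μ k with hAdef
  have hA : MeasurableSet A :=
    (measurableSet_le measurable_const hu).inter (measurableSet_spanningSets μ k)
  have hAfin : μ A < ⊤ := (measure_mono inter_subset_right).trans_lt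
    (measure_spanningSets_lt_top μ k)
  obtain ⟨E, hEm, hEA, hE0, hElt, hEd⟩ := aux_seq μ hna A hA hk hAfin
    (fun n => ENNReal.ofReal (Real.exp (-(n : ℝ) - ((n : ℝ) + 1) ^ 2 / 2)))
    (fun n => ENNReal.ofReal_pos.mpr (Real.exp_pos _))
  have hEtop : ∀ n, μ (E n) ≠ ⊤ := fun n => ((measure_mono (hEA n)).trans_lt hAfin).ne
  have hm0 : ∀ n, 0 < (μ (E n)).toReal := fun n => ENNReal.toReal_pos (hE0 n).ne' (hEtop n)
  have hmE : ∀ n, μ (E n) = ENNReal.ofReal (μ (E n)).toReal :=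
    fun n => (ENNReal.ofReal_toReal (hEtop n)).symm
  have hlog : ∀ n : ℕ, Real.log (μ (E n)).toReal ≤ -(n : ℝ) - ((n : ℝ) + 1) ^ 2 / 2 := by
    intro n
    rw [Real.log_le_iff_le_exp (hm0 n)]
    exact ENNReal.toReal_le_of_le_ofReal (Real.exp_pos _).le (hElt n).le
  obtain ⟨a, han, ha⟩ : ∃ a : ℕ → ℝ, (∀ n : ℕ, (n : ℝ) ≤ a n) ∧
      ∀ n : ℕ, (a n + 1) ^ 2 / 2 = -(n : ℝ) - Real.log (μ (E n)).toReal := by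
    refine ⟨fun n => Real.sqrt (2 * (-(n : ℝ) - Real.log (μ (E n)).toReal)) - 1,
      fun n => ?_, fun n => ?_⟩
    · have := Real.le_sqrt_of_sq_le (x := (n : ℝ) + 1)
        (y := 2 * (-(n : ℝ) - Real.log (μ (E n)).toReal)) (by linarith [hlog n])
      linarith
    · have h := hlog n
      have : 0 ≤ 2 * (-(n : ℝ) - Real.log (μ (E n)).toReal) := by
        nlinarith [sq_nonneg ((n : ℝ) + 1)]
      simp only [sub_add_cancel]
      rw [Real.sq_sqrt this]; ring
  have ha0 : ∀ n, 0 ≤ a n := fun n => (Nat.cast_nonneg n).trans (han n)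
  obtain ⟨g, hg0, hgm, hgint⟩ := exists_pos_lintegral_lt_of_sigmaFinite μ
    (ε := 1) one_ne_zero
  let U : Set T := ⋃ n, E n
  have hU : MeasurableSet U := MeasurableSet.iUnion hEm
  -- the function `c`
  obtain ⟨c₁, hc₁m, hc₁⟩ := exists_measurable_piecewise E hEm (fun n _ => a n)
    (fun n => measurable_const) (by
      intro i j hij x hx
      exact absurd hx.2 (Set.disjoint_left.mp (hEd hij) hx.1))
  classical
  let c : T → ℝ := U.piecewise c₁ (fun t => Real.log (min (g t : ℝ) 1 ) - 1)
  have hcm : Measurable c := by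
    refine Measurable.piecewise hU hc₁m ?_
    exact (Real.measurable_log.comp ((measurable_coe_nnreal_real.comp hgm).min
      measurable_const)).sub_const 1
  have hcE : ∀ n, ∀ t ∈ E n, c t = a n := by
    intro n t ht
    have : t ∈ U := mem_iUnion.mpr ⟨n, ht⟩
    simp only [c, Set.piecewise_eq_of_mem _ _ _ this]
    exact hc₁ n ht
  refine ⟨c, hcm, ?_, (k : ℝ) + 1, by positivity, ?_⟩
  · rw [← lintegral_add_compl _ hU]
    refine ENNReal.add_lt_top.mpr ⟨?_, ?_⟩
    · rw [lintegral_iUnion hEm hEd]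
      have hval : ∀ n : ℕ, ∫⁻ t in E n, ENNReal.ofReal (φ (c t)) ∂μ
          = ENNReal.ofReal (Real.exp (-(n : ℝ))) := by
        intro n
        rw [setLIntegral_congr_fun (g := fun _ => ENNReal.ofReal (φ (a n))) (hEm n)
          (fun t ht => by simp only [hcE n t ht]), setLIntegral_const, hmE n,
          ← ENNReal.ofReal_mul (by rw [hφ, if_pos (ha0 n)]; positivity), hφ, if_pos (ha0 n), ha n,
          Real.exp_sub, Real.exp_log (hm0 n), div_mul_cancel₀ _ (hm0 n).ne']
      simp_rw [hval]
      rw [← ENNReal.ofReal_tsum_of_nonneg (fun n => (Real.exp_pos _).le)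
        Real.summable_exp_neg_nat]
      exact ENNReal.ofReal_lt_top
    · refine lt_of_le_of_lt ?_ (hgint.trans ENNReal.one_lt_top)
      refine le_trans ?_ (setLIntegral_le_lintegral Uᶜ _)
      refine setLIntegral_mono' hU.compl (fun t ht => ?_)
      have hg : 0 < (g t : ℝ) := hg0 t
      have hmin : 0 < min (g t : ℝ) 1 := lt_min hg one_pos
      have hct : c t = Real.log (min (g t : ℝ) 1) - 1 :=
        Set.piecewise_eq_of_notMem _ _ _ ht
      have hl : Real.log (min (g t : ℝ) 1) ≤ 0 :=
        Real.log_nonpos hmin.le (min_le_right _ _)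
      rw [hct, hφ, if_neg (by linarith)]
      rw [← ENNReal.ofReal_coe_nnreal]
      apply ENNReal.ofReal_le_ofReal
      calc Real.exp (Real.log (min (g t : ℝ) 1) - 1 + 1 / 2)
          ≤ Real.exp (Real.log (min (g t : ℝ) 1)) := Real.exp_le_exp.mpr (by linarith)
        _ = min (g t : ℝ) 1 := Real.exp_log hmin
        _ ≤ g t := min_le_left _ _
  · rw [eq_top_iff]
    refine le_trans ?_ (setLIntegral_le_lintegral U _)
    rw [lintegral_iUnion hEm hEd]
    have hval : ∀ n : ℕ, 1 ≤ ∫⁻ t in E n,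
        ENNReal.ofReal (φ (c t + ((k : ℝ) + 1) * u₀ t)) ∂μ := by
      intro n
      calc (1 : ENNReal) ≤ ENNReal.ofReal (Real.exp ((a n + 2) ^ 2 / 2)) * μ (E n) := by
            rw [hmE n, ← ENNReal.ofReal_mul (Real.exp_pos _).le, ENNReal.one_le_ofReal]
            conv_rhs => rw [← Real.exp_log (hm0 n)]
            rw [← Real.exp_add]
            apply Real.one_le_exp
            nlinarith [ha n, han n]
        _ = ∫⁻ t in E n, ENNReal.ofReal (Real.exp ((a n + 2) ^ 2 / 2)) ∂μ := by
            rw [setLIntegral_const]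
        _ ≤ _ := by
            refine setLIntegral_mono' (hEm n) (fun t ht => ?_)
            have h1 : 1 / ((k : ℝ) + 1) ≤ u₀ t := (hEA n ht).1
            rw [div_le_iff₀ (by positivity)] at h1
            have h2 := ha0 n
            rw [hcE n t ht, hφ, if_pos (by linarith)]
            apply ENNReal.ofReal_le_ofReal
            apply Real.exp_le_exp.mpr
            have : a n + 2 ≤ a n + ((k : ℝ) + 1) * u₀ t + 1 := by linarith
            gcongr
    calc (⊤ : ENNReal) = ∑' _ : ℕ, (1 : ENNReal) :=
          (ENNReal.tsum_const_eq_top_of_ne_zero one_ne_zero).symm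
      _ ≤ _ := ENNReal.tsum_le_tsum hval
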